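/- Let (P_t)_{t≥0} be a Feller, stochastically continuous Markov transition semigroup on a Polish metric space 𝒳 that has the e-property, and suppose there exists z ∈ 𝒳 such that for every δ > 0 and every x ∈ 𝒳 one has liminf_{T→∞} Q^T(x, B(z,δ)) > 0. Then the semigroup admits a unique invariant probability measure μ*, and moreover Q^T ν converges weakly to μ* as T → ∞ for every Borel probability measure ν whose support is contained in 𝒯. -/

import Mathlib

open MeasureTheory Filter Topology Metric Set

noncomputable section

/-- A Markov transition semigroup on a measurable space `X`: a jointly measurable family
of Markov probability kernels `P t x` with `P 0 x = δ_x` and the Chapman–Kolmogorov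
semigroup property for nonnegative times. -/
structure MarkovSemigroup (X : Type*) [MeasurableSpace X] where
  P : ℝ → X → MeasureTheory.Measure X
  prob : ∀ t x, MeasureTheory.IsProbabilityMeasure (P t x)
  meas : Measurable fun p : ℝ × X => P p.1 p.2
  init : ∀ x : X, P 0 x = MeasureTheory.Measure.dirac x
  semigroup : ∀ t s : ℝ, 0 ≤ t → 0 ≤ s → ∀ x : X,
    P (t + s) x = (P t x).bind (P s)

namespace MarkovSemigroup

variable {X : Type*} [MeasurableSpace X]

/-- Action `P_t f(x) = ∫ f(y) P_t(x,dy)` on functions. -/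
def act (M : MarkovSemigroup X) (t : ℝ) (f : X → ℝ) (x : X) : ℝ :=
  ∫ y, f y ∂(M.P t x)

/-- Dual action `P_t^* μ` on measures. -/
def dual (M : MarkovSemigroup X) (t : ℝ) (μ : MeasureTheory.Measure X) :
    MeasureTheory.Measure X :=
  μ.bind (M.P t)

/-- The time average `Q^T μ = (1/T) ∫_0^T P_s^* μ ds` (with the convention
`Q^T μ = μ` for `T ≤ 0`). -/
def QM (M : MarkovSemigroup X) (T : ℝ) (μ : MeasureTheory.Measure X) :
    MeasureTheory.Measure X :=
  if T ≤ 0 then μ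
  else ((ENNReal.ofReal (1 / T)) • (volume.restrict (Set.Ioc (0 : ℝ) T))).bind
    fun s => M.dual s μ

/-- `Q^T(x,·) := Q^T δ_x`. -/
def Q (M : MarkovSemigroup X) (T : ℝ) (x : X) : MeasureTheory.Measure X :=
  M.QM T (MeasureTheory.Measure.dirac x)

/-- Iterated averages: for `ts = [t_k, …, t_1]`, `QMs ts μ = Q^{t_k}(⋯(Q^{t_1} μ)⋯)`. -/
def QMs (M : MarkovSemigroup X) (ts : List ℝ) (μ : MeasureTheory.Measure X) :
    MeasureTheory.Measure X :=
  ts.foldr (fun t ν => M.QM t ν) μ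

/-- A measure is invariant if `P_t^* μ = μ` for all `t ≥ 0`. -/
def Invariant (M : MarkovSemigroup X) (μ : MeasureTheory.Measure X) : Prop :=
  ∀ t : ℝ, 0 ≤ t → M.dual t μ = μ

section TopologicalDefs

variable [TopologicalSpace X]

/-- Bounded continuous real functions. -/
def IsBddContinuous (f : X → ℝ) : Prop :=
  Continuous f ∧ ∃ C : ℝ, ∀ x, |f x| ≤ C

/-- The Feller property: `P_t` maps bounded continuous functions to continuous ones. -/
def Feller (M : MarkovSemigroup X) : Prop :=
  ∀ t : ℝ, 0 ≤ t → ∀ f : X → ℝ, MarkovSemigroup.IsBddContinuous f →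
    Continuous (M.act t f)

/-- Stochastic continuity: `P_t f(x) → f(x)` as `t → 0+`. -/
def StochasticallyContinuous (M : MarkovSemigroup X) : Prop :=
  ∀ f : X → ℝ, MarkovSemigroup.IsBddContinuous f → ∀ x : X,
    Filter.Tendsto (fun t : ℝ => M.act t f x) (nhdsWithin 0 (Set.Ioi 0)) (nhds (f x))

/-- Weak convergence of `Q^T ν` to `μ` as `T → ∞`. -/
def QTendsto (M : MarkovSemigroup X) (ν μ : MeasureTheory.Measure X) : Prop :=
  ∀ f : X → ℝ, MarkovSemigroup.IsBddContinuous f →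
    Filter.Tendsto (fun T : ℝ => ∫ x, f x ∂(M.QM T ν)) Filter.atTop
      (nhds (∫ x, f x ∂μ))

/-- Weak-* mean ergodicity with limit `μstar`. -/
def WeakStarMeanErgodic (M : MarkovSemigroup X) (μstar : MeasureTheory.Measure X) : Prop :=
  ∀ ν : MeasureTheory.Measure X, MeasureTheory.IsProbabilityMeasure ν → M.QTendsto ν μstar

/-- Tightness of the family `(Q^T(x,·))_{T>0}`. -/
def TightAt (M : MarkovSemigroup X) (x : X) : Prop :=
  ∀ ε : ℝ, 0 < ε → ∃ K : Set X, IsCompact K ∧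
    ∀ T : ℝ, 0 < T → 1 - ε ≤ ((M.Q T x) K).toReal

end TopologicalDefs

end MarkovSemigroup

/-- Topological support of a measure: points all of whose open neighborhoods
have positive mass. -/
def msupport {X : Type*} [MeasurableSpace X] [TopologicalSpace X]
    (μ : MeasureTheory.Measure X) : Set X :=
  {x : X | ∀ U : Set X, IsOpen U → x ∈ U → 0 < μ U}

/-- Total variation distance between two (finite) measures, as the supremum over
Borel sets of the discrepancy of masses. -/
def tvDist {X : Type*} [MeasurableSpace X] (μ ν : MeasureTheory.Measure X) : ℝ :=
  ⨆ B : {B : Set X // MeasurableSet B}, |(μ B.1).toReal - (ν B.1).toReal|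

section MetricDefs

variable {X : Type*} [MeasurableSpace X] [PseudoMetricSpace X]

/-- Bounded Lipschitz real functions. -/
def IsBddLipschitz (ψ : X → ℝ) : Prop :=
  (∃ K : NNReal, LipschitzWith K ψ) ∧ ∃ C : ℝ, ∀ x, |ψ x| ≤ C

/-- The e-property: equicontinuity of `(P_t ψ)_{t ≥ 0}` at every point, for every
bounded Lipschitz `ψ`. -/
def MarkovSemigroup.EProperty (M : MarkovSemigroup X) : Prop :=
  ∀ ψ : X → ℝ, IsBddLipschitz ψ → ∀ x : X, ∀ ε : ℝ, 0 < ε →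
    ∃ δ : ℝ, 0 < δ ∧ ∀ z : X, dist z x < δ → ∀ t : ℝ, 0 ≤ t →
      |M.act t ψ z - M.act t ψ x| < ε

end MetricDefs

section Bumps

variable {X : Type*} [MetricSpace X] {E : ℕ → Set X} {ρ : ℝ}

/-- The bump function of the union of the sets `E i` over those `i` with `A i = true`. -/
def bumpUnion (E : ℕ → Set X) (hρ : 0 < ρ) (A : ℕ → Bool) (x : X) : ℝ :=
  thickenedIndicator hρ (⋃ i ∈ {i | A i = true}, E i) x

/-- The bump function of `E i`. -/
def bump (E : ℕ → Set X) (hρ : 0 < ρ) (i : ℕ) (x : X) : ℝ :=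
  thickenedIndicator hρ (E i) x

lemma isBddLipschitz_thickenedIndicator (hρ : 0 < ρ) (S : Set X) :
    IsBddLipschitz fun x => (thickenedIndicator hρ S x : ℝ) := by
  refine ⟨⟨_, lipschitzWith_thickenedIndicator hρ S⟩, 1, fun x => ?_⟩
  rw [NNReal.abs_eq]
  exact_mod_cast thickenedIndicator_le_one hρ S x

variable (hρ : 0 < ρ)

lemma bump_nonneg (i : ℕ) (x : X) : 0 ≤ bump E hρ i x := NNReal.coe_nonneg _

lemma bump_le_one (i : ℕ) (x : X) : bump E hρ i x ≤ 1 := by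
  exact_mod_cast thickenedIndicator_le_one hρ (E i) x

lemma bump_eq_one {i : ℕ} {x : X} (hx : x ∈ E i) : bump E hρ i x = 1 := by
  rw [bump, thickenedIndicator_one hρ _ hx, NNReal.coe_one]

lemma bump_eq_zero {i : ℕ} {x : X} (hx : x ∉ thickening ρ (E i)) : bump E hρ i x = 0 := by
  rw [bump, thickenedIndicator_zero hρ _ hx, NNReal.coe_zero]

lemma bumpUnion_eq_zero {A : ℕ → Bool} {x : X}
    (hx : ∀ i, A i = true → x ∉ thickening ρ (E i)) : bumpUnion E hρ A x = 0 := by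
  rw [bumpUnion, thickenedIndicator_zero hρ, NNReal.coe_zero]
  simpa [thickening_iUnion] using hx

variable (hdisj : Pairwise fun i j => Disjoint (thickening ρ (E i)) (thickening ρ (E j)))

include hdisj

lemma bumpUnion_of_mem {i : ℕ} {x : X} (hx : x ∈ thickening ρ (E i)) (A : ℕ → Bool) :
    bumpUnion E hρ A x = if A i then bump E hρ i x else 0 := by
  have hne : ∀ j, j ≠ i → x ∉ thickening ρ (E j) := fun j hj hxj =>
    disjoint_left.1 (hdisj hj) hxj hx
  split_ifs with hA
  · have h : infEDist x (⋃ i ∈ {i | A i = true}, E i) = infEDist x (E i) := by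
      refine le_antisymm (infEDist_anti (subset_biUnion_of_mem (u := E) hA)) ?_
      rw [le_infEDist]
      intro y hy
      simp only [mem_iUnion] at hy
      obtain ⟨j, -, hyj⟩ := hy
      rcases eq_or_ne j i with rfl | hj
      · exact infEDist_le_edist_of_mem hyj
      · have h1 : infEDist x (E i) < ENNReal.ofReal ρ := hx
        have h2 : ENNReal.ofReal ρ ≤ infEDist x (E j) := not_lt.1 (hne j hj)
        exact (h1.le.trans h2).trans (infEDist_le_edist_of_mem hyj)
    simp only [bumpUnion, bump, thickenedIndicator_apply, thickenedIndicatorAux, h]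
  · refine bumpUnion_eq_zero hρ fun j hj => hne j ?_
    rintro rfl
    exact hA hj

lemma continuous_bumpUnion (x : X) : Continuous fun A => bumpUnion E hρ A x := by
  by_cases hx : ∃ i, x ∈ thickening ρ (E i)
  · obtain ⟨i, hi⟩ := hx
    simp_rw [bumpUnion_of_mem hρ hdisj hi]
    exact (continuous_of_discreteTopology
      (f := fun b : Bool => if b then bump E hρ i x else 0)).comp (continuous_apply i)
  · push Not at hx
    simp_rw [bumpUnion_eq_zero hρ fun i _ => hx i]
    exact continuous_const

lemma bump_eq_bumpUnion_sub (A : ℕ → Bool) (i : ℕ) (x : X) : bump E hρ i x =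
    bumpUnion E hρ (Function.update A i true) x - bumpUnion E hρ (Function.update A i false) x := by
  by_cases hx : ∃ j, x ∈ thickening ρ (E j)
  · obtain ⟨j, hj⟩ := hx
    simp only [bumpUnion_of_mem hρ hdisj hj]
    rcases eq_or_ne j i with rfl | hji
    · simp
    · rw [bump_eq_zero hρ fun h => disjoint_left.1 (hdisj hji) hj h]
      simp [Function.update_of_ne hji]
  · push Not at hx
    rw [bump_eq_zero hρ (hx i), bumpUnion_eq_zero hρ fun i _ => hx i,
      bumpUnion_eq_zero hρ fun i _ => hx i, sub_zero]

lemma sum_bump_le_one (s : Finset ℕ) (x : X) : ∑ i ∈ s, bump E hρ i x ≤ 1 := by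
  by_cases hx : ∃ j, x ∈ thickening ρ (E j)
  · obtain ⟨j, hj⟩ := hx
    have h0 : ∀ i, i ≠ j → bump E hρ i x = 0 := fun i hij =>
      bump_eq_zero hρ fun h => disjoint_left.1 (hdisj hij) h hj
    by_cases hjs : j ∈ s
    · rw [Finset.sum_eq_single_of_mem j hjs fun i _ hij => h0 i hij]
      exact bump_le_one hρ j x
    · rw [Finset.sum_eq_zero fun i hi => h0 i fun h => hjs (h ▸ hi)]
      exact zero_le_one
  · push Not at hx
    rw [Finset.sum_eq_zero fun i _ => bump_eq_zero hρ (hx i)]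
    exact zero_le_one

end Bumps

lemma exists_finite_cover_of_lt_measure {X : Type*} [MetricSpace X]
    [SecondCountableTopology X] [MeasurableSpace X] (μ : Measure X) {S : Set X}
    {ε : ENNReal} (h : ε < μ S) {r : ℝ} (hr : 0 < r) :
    ∃ G ⊆ S, G.Finite ∧ ε < μ (⋃ y ∈ G, ball y r) := by
  obtain ⟨D, hDS, hD, hcl⟩ :=
    (TopologicalSpace.IsSeparable.of_separableSpace S).exists_countable_dense_subset
  have hcov : S ⊆ ⋃ y ∈ D, ball y r := fun x hx => by
    obtain ⟨y, hy, hxy⟩ := Metric.mem_closure_iff.1 (hcl hx) r hr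
    exact mem_iUnion₂.2 ⟨y, hy, hxy⟩
  have hne : D.Nonempty := by
    rw [nonempty_iff_ne_empty]
    rintro rfl
    have : S = ∅ := by simpa using hcov
    simp [this] at h
  obtain ⟨d, rfl⟩ := hD.exists_eq_range hne
  rw [biUnion_range] at hcov
  have h' := h.trans_le (measure_mono hcov)
  rw [measure_iUnion_eq_iSup_accumulate, lt_iSup_iff] at h'
  obtain ⟨n, hn⟩ := h'
  refine ⟨d '' Iic n, (image_subset_range _ _).trans hDS, (finite_Iic n).image d, ?_⟩
  rwa [biUnion_image]

lemma ae_mem_msupport {X : Type*} [MetricSpace X] [SecondCountableTopology X]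
    [MeasurableSpace X] (ν : Measure X) : ∀ᵐ x ∂ν, x ∈ msupport ν := by
  filter_upwards [Measure.support_mem_ae (μ := ν)] with x hx U hU hxU
  exact (Measure.mem_support_iff_forall x).1 hx U (hU.mem_nhds hxU)

namespace MarkovSemigroup

open ProbabilityTheory

section Averages

variable {X : Type*} [MeasurableSpace X]

/-- The transition probabilities of a Markov semigroup, as a kernel in time and space. -/
def kernel (M : MarkovSemigroup X) : Kernel (ℝ × X) X :=
  ⟨fun p => M.P p.1 p.2, M.meas⟩

instance (M : MarkovSemigroup X) : IsMarkovKernel M.kernel :=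
  ⟨fun p => M.prob p.1 p.2⟩

instance (M : MarkovSemigroup X) (t : ℝ) (x : X) : IsProbabilityMeasure (M.P t x) := M.prob t x

lemma measurable_P (M : MarkovSemigroup X) (t : ℝ) : Measurable (M.P t) :=
  M.meas.comp measurable_prodMk_left

/-- The uniform distribution on `(0, T]`. -/
def uniformTime (T : ℝ) : Measure ℝ :=
  ENNReal.ofReal (1 / T) • volume.restrict (Ioc (0 : ℝ) T)

instance (T : ℝ) : IsFiniteMeasure (uniformTime T) := by
  refine ⟨?_⟩
  simp only [uniformTime, Measure.smul_apply, Measure.restrict_apply_univ, Real.volume_Ioc,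
    smul_eq_mul]
  exact ENNReal.mul_lt_top ENNReal.ofReal_lt_top ENNReal.ofReal_lt_top

lemma isProbabilityMeasure_uniformTime {T : ℝ} (hT : 0 < T) :
    IsProbabilityMeasure (uniformTime T) := by
  refine ⟨?_⟩
  simp only [uniformTime, Measure.smul_apply, Measure.restrict_apply_univ, Real.volume_Ioc,
    smul_eq_mul, sub_zero]
  rw [← ENNReal.ofReal_mul (by positivity), one_div_mul_cancel hT.ne', ENNReal.ofReal_one]

lemma integral_uniformTime {T : ℝ} (hT : 0 < T) (a : ℝ → ℝ) :
    ∫ s, a s ∂(uniformTime T) = 1 / T * ∫ s in (0 : ℝ)..T, a s := by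
  rw [uniformTime, integral_smul_measure, intervalIntegral.integral_of_le hT.le,
    ENNReal.toReal_ofReal (by positivity), smul_eq_mul]

lemma ae_uniformTime (T : ℝ) : ∀ᵐ s ∂(uniformTime T), 0 < s ∧ s ≤ T :=
  Measure.ae_smul_measure (ae_restrict_mem measurableSet_Ioc) _

lemma integrable_of_abs_le {Y : Type*} [MeasurableSpace Y] {μ : Measure Y} [IsFiniteMeasure μ]
    {f : Y → ℝ} (hf : Measurable f) {C : ℝ} (hC : ∀ y, |f y| ≤ C) : Integrable f μ :=
  Integrable.of_bound hf.aestronglyMeasurable C (ae_of_all _ hC)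

lemma abs_integral_le {Y : Type*} [MeasurableSpace Y] {μ : Measure Y} [IsProbabilityMeasure μ]
    {f : Y → ℝ} {C : ℝ} (hC : ∀ᵐ y ∂μ, |f y| ≤ C) : |∫ y, f y ∂μ| ≤ C := by
  simpa using norm_integral_le_of_norm_le_const (μ := μ) (f := f) hC

lemma integral_bind_kernel {Y Z : Type*} [MeasurableSpace Y] [MeasurableSpace Z]
    {μ : Measure Y} [IsProbabilityMeasure μ] (κ : Kernel Y Z) [IsMarkovKernel κ]
    {f : Z → ℝ} (hf : Measurable f) {C : ℝ} (hC : ∀ y, |f y| ≤ C) :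
    ∫ z, f z ∂(μ.bind κ) = ∫ y, ∫ z, f z ∂(κ y) ∂μ := by
  have h : μ.bind κ = (κ ∘ₖ Kernel.const Unit μ) () := by
    rw [Kernel.comp_apply, Kernel.const_apply]
  rw [h, Kernel.integral_comp (integrable_of_abs_le hf hC), Kernel.const_apply]

/-- Averaging against uniformly distributed times is almost shift invariant. -/
lemma abs_integral_uniformTime_shift_sub_le {a : ℝ → ℝ} (ha : Measurable a) {C : ℝ}
    (hC : ∀ s, |a s| ≤ C) {t T : ℝ} (ht : 0 ≤ t) (hT : 0 < T) :
    |∫ s, a (s + t) ∂(uniformTime T) - ∫ s, a s ∂(uniformTime T)| ≤ 2 * C * t / T := by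
  have hi : ∀ u v, IntervalIntegrable a volume u v := fun u v =>
    ⟨integrable_of_abs_le ha hC, integrable_of_abs_le ha hC⟩
  rw [integral_uniformTime hT, integral_uniformTime hT,
    intervalIntegral.integral_comp_add_right, ← mul_sub,
    intervalIntegral.integral_interval_sub_interval_comm' (hi _ _) (hi _ _) (hi _ _)]
  have h1 := intervalIntegral.norm_integral_le_of_norm_le_const (a := T) (b := T + t) (f := a)
    (C := C) fun x _ => hC x
  have h2 := intervalIntegral.norm_integral_le_of_norm_le_const (a := 0) (b := 0 + t) (f := a)
    (C := C) fun x _ => hC x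
  simp only [zero_add, Real.norm_eq_abs, add_sub_cancel_left, sub_zero, abs_of_nonneg ht] at h1 h2
  rw [abs_mul, abs_of_pos (by positivity : 0 < 1 / T), zero_add, add_comm T t] at *
  have h3 := abs_sub (∫ x in T..t + T, a x) (∫ x in 0..t, a x)
  rw [one_div, inv_mul_eq_div]
  gcongr
  linarith

variable (M : MarkovSemigroup X)

lemma QM_eq_bind {T : ℝ} (hT : 0 < T) (μ : Measure X) [SFinite μ] :
    M.QM T μ = ((uniformTime T).prod μ).bind M.kernel := by
  rw [QM, if_neg hT.not_ge]
  have hm : Measurable fun s => M.dual s μ := by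
    refine Measure.measurable_of_measurable_coe _ fun B hB => ?_
    have h : (fun s => M.dual s μ B) = fun s => ∫⁻ x, M.kernel (s, x) B ∂μ := by
      ext s
      exact Measure.bind_apply hB (M.measurable_P s).aemeasurable
    rw [h]
    exact (M.kernel.measurable_coe hB).lintegral_prod_right'
  ext B hB
  rw [Measure.bind_apply hB hm.aemeasurable, Measure.bind_apply hB M.kernel.aemeasurable,
    lintegral_prod _ (M.kernel.measurable_coe hB).aemeasurable]
  refine lintegral_congr fun s => ?_
  exact Measure.bind_apply hB (M.measurable_P s).aemeasurable

lemma isProbabilityMeasure_QM (T : ℝ) (μ : Measure X) [IsProbabilityMeasure μ] :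
    IsProbabilityMeasure (M.QM T μ) := by
  rcases le_or_gt T 0 with hT | hT
  · rwa [QM, if_pos hT]
  · have := isProbabilityMeasure_uniformTime hT
    rw [M.QM_eq_bind hT]
    infer_instance

instance (T : ℝ) (x : X) : IsProbabilityMeasure (M.Q T x) :=
  M.isProbabilityMeasure_QM T _

variable {f : X → ℝ} (hf : Measurable f) {C : ℝ} (hC : ∀ x, |f x| ≤ C)

include hf in
lemma measurable_act_uncurry : Measurable fun p : ℝ × X => M.act p.1 f p.2 :=
  (hf.stronglyMeasurable.integral_kernel (κ := M.kernel)).measurable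

include hf in
lemma measurable_act (t : ℝ) : Measurable (M.act t f) :=
  (M.measurable_act_uncurry hf).comp measurable_prodMk_left

include hC in
lemma abs_act_le (t : ℝ) (x : X) : |M.act t f x| ≤ C :=
  abs_integral_le (ae_of_all _ hC)

include hf hC in
lemma act_act {t s : ℝ} (ht : 0 ≤ t) (hs : 0 ≤ s) (x : X) :
    M.act t (M.act s f) x = M.act (t + s) f x := by
  have h := integral_bind_kernel (μ := M.P t x) (M.kernel.comap (fun y => (s, y))
    measurable_prodMk_left) hf hC
  simp only [act, M.semigroup t s ht hs x]
  exact h.symm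

include hf hC in
lemma integral_dual (t : ℝ) (μ : Measure X) [IsProbabilityMeasure μ] :
    ∫ x, f x ∂(M.dual t μ) = ∫ x, M.act t f x ∂μ :=
  integral_bind_kernel (μ := μ) (M.kernel.comap (fun y => (t, y)) measurable_prodMk_left) hf hC

instance (t : ℝ) (μ : Measure X) [IsProbabilityMeasure μ] : IsProbabilityMeasure (M.dual t μ) :=
  inferInstanceAs (IsProbabilityMeasure
    (μ.bind (M.kernel.comap (fun y => (t, y)) measurable_prodMk_left)))

include hf hC in
lemma integral_QM {T : ℝ} (hT : 0 < T) (μ : Measure X) [IsProbabilityMeasure μ] :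
    ∫ x, f x ∂(M.QM T μ) = ∫ s, ∫ x, M.act s f x ∂μ ∂(uniformTime T) := by
  have := isProbabilityMeasure_uniformTime hT
  rw [M.QM_eq_bind hT, integral_bind_kernel M.kernel hf hC]
  exact integral_prod _ (integrable_of_abs_le (M.measurable_act_uncurry hf)
    fun p => M.abs_act_le hC p.1 p.2)

include hf hC in
lemma integral_Q {T : ℝ} (hT : 0 < T) (x : X) :
    ∫ y, f y ∂(M.Q T x) = ∫ s, M.act s f x ∂(uniformTime T) := by
  rw [Q, M.integral_QM hf hC hT]
  simp_rw [integral_dirac' _ _ (M.measurable_act hf _).stronglyMeasurable]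

include hf in
lemma measurable_integral_uniformTime_act (T : ℝ) :
    Measurable fun x => ∫ s, M.act s f x ∂(uniformTime T) :=
  ((M.measurable_act_uncurry hf).comp
    measurable_swap).stronglyMeasurable.integral_prod_right'.measurable

include hf hC in
lemma measurable_integral_Q {T : ℝ} (hT : 0 < T) : Measurable fun x => ∫ y, f y ∂(M.Q T x) := by
  simp_rw [M.integral_Q hf hC hT]
  exact M.measurable_integral_uniformTime_act hf T

include hC in
lemma abs_integral_Q_le (T : ℝ) (x : X) : |∫ y, f y ∂(M.Q T x)| ≤ C :=
  abs_integral_le (ae_of_all _ hC)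

include hf hC in
lemma integral_integral_Q {T : ℝ} (hT : 0 < T) (μ : Measure X) [IsProbabilityMeasure μ] :
    ∫ x, ∫ y, f y ∂(M.Q T x) ∂μ = ∫ s, ∫ x, M.act s f x ∂μ ∂(uniformTime T) := by
  have := isProbabilityMeasure_uniformTime hT
  simp_rw [M.integral_Q hf hC hT]
  exact integral_integral_swap (integrable_of_abs_le
    ((M.measurable_act_uncurry hf).comp measurable_swap) fun p => M.abs_act_le hC p.2 p.1)

include hf hC in
lemma integral_QM_eq_integral_integral_Q {T : ℝ} (hT : 0 < T) (μ : Measure X)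
    [IsProbabilityMeasure μ] :
    ∫ x, f x ∂(M.QM T μ) = ∫ x, ∫ y, f y ∂(M.Q T x) ∂μ := by
  rw [M.integral_integral_Q hf hC hT, M.integral_QM hf hC hT]

include hf hC in
lemma integral_integral_Q_of_invariant {T : ℝ} (hT : 0 < T) {μ : Measure X}
    [IsProbabilityMeasure μ] (hμ : M.Invariant μ) :
    ∫ x, ∫ y, f y ∂(M.Q T x) ∂μ = ∫ x, f x ∂μ := by
  have := isProbabilityMeasure_uniformTime hT
  rw [M.integral_integral_Q hf hC hT]
  have h : ∀ᵐ s ∂(uniformTime T), ∫ x, M.act s f x ∂μ = ∫ x, f x ∂μ := by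
    filter_upwards [ae_uniformTime T] with s hs
    rw [← M.integral_dual hf hC, hμ s hs.1.le]
  rw [integral_congr_ae h]
  simp

include hf hC in
/-- Time averages are asymptotically invariant. -/
lemma abs_integral_act_QM_sub_le {t T : ℝ} (ht : 0 ≤ t) (hT : 0 < T) (μ : Measure X)
    [IsProbabilityMeasure μ] :
    |∫ x, M.act t f x ∂(M.QM T μ) - ∫ x, f x ∂(M.QM T μ)| ≤ 2 * C * t / T := by
  rw [M.integral_QM hf hC hT, M.integral_QM (M.measurable_act hf t) (M.abs_act_le hC t) hT]
  have h : ∫ s, ∫ x, M.act s (M.act t f) x ∂μ ∂(uniformTime T) =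
      ∫ s, ∫ x, M.act (s + t) f x ∂μ ∂(uniformTime T) := by
    refine integral_congr_ae ?_
    filter_upwards [ae_uniformTime T] with s hs
    simp_rw [M.act_act hf hC hs.1.le ht]
  rw [h]
  exact abs_integral_uniformTime_shift_sub_le (a := fun s => ∫ x, M.act s f x ∂μ)
    (M.measurable_act_uncurry hf).stronglyMeasurable.integral_prod_right'.measurable
    (fun s => abs_integral_le (ae_of_all _ (M.abs_act_le hC s))) ht hT

include hf hC in
lemma abs_integral_integral_Q_sub_le {S T : ℝ} (hS : 0 < S) (hT : 0 < T) (μ : Measure X)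
    [IsProbabilityMeasure μ] (hC0 : 0 ≤ C) :
    |∫ x, ∫ y, f y ∂(M.Q S x) ∂(M.QM T μ) - ∫ x, f x ∂(M.QM T μ)| ≤ 2 * C * S / T := by
  have := isProbabilityMeasure_uniformTime hS
  have := M.isProbabilityMeasure_QM T μ
  rw [M.integral_integral_Q hf hC hS]
  have h : ∫ x, f x ∂(M.QM T μ) = ∫ _, ∫ x, f x ∂(M.QM T μ) ∂(uniformTime S) := by simp
  rw [h, ← integral_sub _ (integrable_const _)]
  · refine abs_integral_le ?_
    filter_upwards [ae_uniformTime S] with s hs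
    refine (M.abs_integral_act_QM_sub_le hf hC hs.1.le hT μ).trans ?_
    gcongr
    exact hs.2
  · exact integrable_of_abs_le
      (M.measurable_act_uncurry hf).stronglyMeasurable.integral_prod_right'.measurable
      (fun s => abs_integral_le (ae_of_all _ (M.abs_act_le hC s)))

include hf hC in
lemma act_integral_Q {t T : ℝ} (ht : 0 ≤ t) (hT : 0 < T) (x : X) :
    M.act t (fun y => ∫ w, f w ∂(M.Q T y)) x = ∫ w, M.act t f w ∂(M.Q T x) := by
  have h := M.integral_integral_Q hf hC hT (M.P t x)
  rw [act, h, M.integral_Q (M.measurable_act hf t) (M.abs_act_le hC t) hT]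
  refine integral_congr_ae ?_
  filter_upwards [ae_uniformTime T] with s hs
  rw [M.act_act hf hC hs.1.le ht, add_comm, ← M.act_act hf hC ht hs.1.le, act]

include hf hC in
lemma abs_act_integral_Q_sub_le {t T : ℝ} (ht : 0 ≤ t) (hT : 0 < T) (x : X) :
    |M.act t (fun y => ∫ w, f w ∂(M.Q T y)) x - ∫ w, f w ∂(M.Q T x)| ≤ 2 * C * t / T := by
  rw [M.act_integral_Q hf hC ht hT]
  exact M.abs_integral_act_QM_sub_le hf hC ht hT _

include hf hC in
/-- A bound on the oscillation of `P_t f` passes to the time averages. -/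
lemma abs_integral_Q_sub_integral_Q_le {x y : X} {ε : ℝ}
    (h : ∀ t, 0 ≤ t → |M.act t f x - M.act t f y| ≤ ε) {T : ℝ} (hT : 0 < T) :
    |∫ w, f w ∂(M.Q T x) - ∫ w, f w ∂(M.Q T y)| ≤ ε := by
  have := isProbabilityMeasure_uniformTime hT
  have hi : ∀ w, Integrable (fun s => M.act s f w) (uniformTime T) := fun w =>
    integrable_of_abs_le ((M.measurable_act_uncurry hf).comp measurable_prodMk_right)
      fun s => M.abs_act_le hC s w
  rw [M.integral_Q hf hC hT, M.integral_Q hf hC hT, ← integral_sub (hi x) (hi y)]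
  refine abs_integral_le ?_
  filter_upwards [ae_uniformTime T] with s hs using h s hs.1.le

end Averages

section Uniqueness

variable {X : Type*} [MetricSpace X] [MeasurableSpace X] [BorelSpace X] (M : MarkovSemigroup X)

variable {M} in
/-- The e-property makes the time averages of a bounded Lipschitz function equicontinuous. -/
lemma EProperty.exists_abs_integral_Q_sub_le (hE : M.EProperty) {f : X → ℝ} (hf : IsBddLipschitz f)
    (x : X) {ε : ℝ} (hε : 0 < ε) : ∃ δ : ℝ, 0 < δ ∧ ∀ y, dist y x < δ → ∀ T : ℝ, 0 < T →
      |∫ w, f w ∂(M.Q T y) - ∫ w, f w ∂(M.Q T x)| ≤ ε := by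
  obtain ⟨δ, hδ, h⟩ := hE f hf x ε hε
  obtain ⟨⟨K, hK⟩, C, hC⟩ := hf
  exact ⟨δ, hδ, fun y hy T hT => M.abs_integral_Q_sub_integral_Q_le hK.continuous.measurable hC
    (fun t ht => (h y hy t ht).le) hT⟩

variable {M} in
/-- Time averages of a bounded Lipschitz function accumulate at a continuous harmonic function. -/
lemma EProperty.exists_harmonic [SecondCountableTopology X] [Nonempty X] (hE : M.EProperty)
    {f : X → ℝ} (hf : IsBddLipschitz f) :
    ∃ g : X → ℝ, Continuous g ∧ (∃ C, ∀ x, |g x| ≤ C) ∧ (∀ t, 0 ≤ t → M.act t g = g) ∧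
      ∀ μ : Measure X, IsProbabilityMeasure μ → M.Invariant μ → ∫ x, g x ∂μ = ∫ x, f x ∂μ := by
  have hequi := fun x ε (hε : 0 < ε) => hE.exists_abs_integral_Q_sub_le hf x hε
  obtain ⟨⟨K, hK⟩, C, hC⟩ := hf
  have hfm : Measurable f := hK.continuous.measurable
  set F : ℕ → X → ℝ := fun n x => ∫ w, f w ∂(M.Q (n + 1) x) with hF
  have hpos : ∀ n : ℕ, (0 : ℝ) < n + 1 := fun n => by positivity
  have hFm : ∀ n, Measurable (F n) := fun n => M.measurable_integral_Q hfm hC (hpos n)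
  have hFC : ∀ n x, |F n x| ≤ C := fun n x => M.abs_integral_Q_le hC _ x
  have hcpt : IsCompact (Set.pi univ fun _ : ℕ => Icc (-C) C) :=
    isCompact_univ_pi fun _ => isCompact_Icc
  obtain ⟨a, -, φ, hφ, hlim⟩ := hcpt.tendsto_subseq
    (x := fun n k => F n (TopologicalSpace.denseSeq X k))
    fun n k _ => abs_le.1 (hFC n _)
  rw [tendsto_pi_nhds] at hlim
  have hcau : ∀ x, CauchySeq fun n => F (φ n) x := by
    intro x
    rw [Metric.cauchySeq_iff]
    intro ε hε
    obtain ⟨δ, hδ, h⟩ := hequi x (ε / 4) (by positivity)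
    obtain ⟨k, hk⟩ := (TopologicalSpace.denseRange_denseSeq X).exists_dist_lt x hδ
    rw [dist_comm] at hk
    obtain ⟨N, hN⟩ := Metric.cauchySeq_iff.1 (hlim k).cauchySeq (ε / 4) (by positivity)
    refine ⟨N, fun m hm n hn => ?_⟩
    have h1 := abs_le.1 (h _ hk _ (hpos (φ m)))
    have h2 := abs_le.1 (h _ hk _ (hpos (φ n)))
    have h3 := abs_lt.1 (hN m hm n hn)
    simp only [Function.comp_apply] at h3
    rw [Real.dist_eq, abs_lt]
    constructor <;> simp only [hF] at * <;> linarith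
  choose g hg using fun x => cauchySeq_tendsto_of_complete (hcau x)
  have hgc : Continuous g := by
    rw [Metric.continuous_iff]
    intro x ε hε
    obtain ⟨δ, hδ, h⟩ := hequi x (ε / 2) (by positivity)
    refine ⟨δ, hδ, fun y hy => ?_⟩
    have := le_of_tendsto ((hg y).sub (hg x)).abs
      (Eventually.of_forall fun n => h y hy _ (hpos (φ n)))
    rw [Real.dist_eq]
    linarith
  have hgC : ∀ x, |g x| ≤ C := fun x =>
    le_of_tendsto (hg x).abs (Eventually.of_forall fun n => hFC _ x)
  have hdom : ∀ μ : Measure X, IsProbabilityMeasure μ →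
      Tendsto (fun n => ∫ x, F (φ n) x ∂μ) atTop (𝓝 (∫ x, g x ∂μ)) := fun μ _ =>
    tendsto_integral_of_dominated_convergence (fun _ => C)
      (fun n => (hFm _).aestronglyMeasurable) (integrable_const _)
      (fun n => ae_of_all _ (hFC _)) (ae_of_all _ hg)
  refine ⟨g, hgc, ⟨C, hgC⟩, fun t ht => funext fun x => ?_, fun μ _ hμ => ?_⟩
  · have h0 : Tendsto (fun n => 2 * C * t / ((φ n : ℝ) + 1)) atTop (𝓝 0) :=
      Tendsto.div_atTop tendsto_const_nhds (tendsto_atTop_add_const_right _ _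
        (tendsto_natCast_atTop_atTop.comp hφ.tendsto_atTop))
    have h1 := squeeze_zero_norm
      (f := fun n => M.act t (F (φ n)) x - F (φ n) x)
      (fun n => M.abs_act_integral_Q_sub_le hfm hC ht (hpos (φ n)) x) h0
    have h2 := tendsto_nhds_unique h1 ((hdom (M.P t x) inferInstance).sub (hg x))
    exact (sub_eq_zero.1 h2.symm)
  · refine tendsto_nhds_unique (hdom μ inferInstance) ?_
    simp_rw [hF, fun n => M.integral_integral_Q_of_invariant hfm hC (hpos n) hμ]
    exact tendsto_const_nhds

/-- If the time averages from every point charge every ball around `z`, then continuous harmonic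
functions equal their value at `z` almost surely with respect to any invariant measure. -/
lemma integral_eq_of_harmonic {z : X}
    (hpos : ∀ δ : ℝ, 0 < δ → ∀ x, ∃ n : ℕ, M.Q (n + 1) x (ball z δ) ≠ 0)
    {g : X → ℝ} (hg : Continuous g) {C : ℝ} (hC : ∀ x, |g x| ≤ C)
    (hharm : ∀ t, 0 ≤ t → M.act t g = g) {μ : Measure X} [IsProbabilityMeasure μ]
    (hμ : M.Invariant μ) : ∫ x, g x ∂μ = g z := by
  have hgm := hg.measurable
  have hT : ∀ n : ℕ, (0 : ℝ) < n + 1 := fun n => by positivity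
  have hsqm : Measurable fun x => g x ^ 2 := hgm.pow_const 2
  have hsqC : ∀ x, |g x ^ 2| ≤ C ^ 2 := fun x => by
    rw [abs_pow]
    exact pow_le_pow_left₀ (abs_nonneg _) (hC x) 2
  have hmean : ∀ (n : ℕ) x, ∫ y, g y ∂(M.Q (n + 1) x) = g x := by
    intro n x
    have := isProbabilityMeasure_uniformTime (hT n)
    rw [M.integral_Q hgm hC (hT n)]
    have h : ∀ᵐ s ∂(uniformTime (n + 1)), M.act s g x = g x := by
      filter_upwards [ae_uniformTime (n + 1)] with s hs
      rw [hharm s hs.1.le]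
    rw [integral_congr_ae h]
    simp
  have hvar : ∀ (n : ℕ) x, ∫ y, (g y - g x) ^ 2 ∂(M.Q (n + 1) x) =
      ∫ y, g y ^ 2 ∂(M.Q (n + 1) x) - g x ^ 2 := by
    intro n x
    have h1 : Integrable (fun y => g y ^ 2) (M.Q (n + 1) x) := integrable_of_abs_le hsqm hsqC
    have h2 : Integrable g (M.Q (n + 1) x) := integrable_of_abs_le hgm hC
    have h3 : (fun y => (g y - g x) ^ 2) = fun y => g y ^ 2 - 2 * g x * g y + g x ^ 2 := by
      ext y
      ring
    have h4 : Integrable (fun y => 2 * g x * g y) (M.Q (n + 1) x) := h2.const_mul _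
    have h5 : Integrable (fun y => g y ^ 2 - 2 * g x * g y) (M.Q (n + 1) x) := h1.sub h4
    rw [h3, integral_add h5 (integrable_const _), integral_sub h1 h4, integral_const_mul, hmean]
    simp
    ring
  have hzero : ∀ n : ℕ, ∀ᵐ x ∂μ, ∀ᵐ y ∂(M.Q (n + 1) x), g y = g x := by
    intro n
    have hi1 : Integrable (fun x => ∫ y, g y ^ 2 ∂(M.Q (n + 1) x)) μ :=
      integrable_of_abs_le (M.measurable_integral_Q hsqm hsqC (hT n))
        fun x => M.abs_integral_Q_le hsqC _ x
    have hi2 : Integrable (fun x => g x ^ 2) μ := integrable_of_abs_le hsqm hsqC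
    have h0 : ∫ x, ∫ y, (g y - g x) ^ 2 ∂(M.Q (n + 1) x) ∂μ = 0 := by
      simp_rw [hvar]
      rw [integral_sub hi1 hi2, M.integral_integral_Q_of_invariant hsqm hsqC (hT n) hμ, sub_self]
    have hi : Integrable (fun x => ∫ y, (g y - g x) ^ 2 ∂(M.Q (n + 1) x)) μ := by
      simp_rw [hvar]
      exact hi1.sub hi2
    rw [integral_eq_zero_iff_of_nonneg (fun x => integral_nonneg fun y => sq_nonneg _) hi] at h0
    filter_upwards [h0] with x hx
    have hix : Integrable (fun y => (g y - g x) ^ 2) (M.Q (n + 1) x) :=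
      integrable_of_abs_le (C := (C + C) ^ 2) ((hgm.sub_const _).pow_const 2) fun y => by
        rw [abs_pow]
        exact pow_le_pow_left₀ (abs_nonneg _)
          ((abs_sub _ _).trans (add_le_add (hC y) (hC x))) 2
    rw [Pi.zero_apply, integral_eq_zero_iff_of_nonneg (fun y => sq_nonneg _) hix] at hx
    filter_upwards [hx] with y hy
    exact sub_eq_zero.1 (pow_eq_zero_iff two_ne_zero |>.1 hy)
  have hconst : ∀ᵐ x ∂μ, g x = g z := by
    filter_upwards [ae_all_iff.2 hzero] with x hx
    refine eq_of_forall_dist_le fun ε hε => ?_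
    obtain ⟨δ, hδ, h⟩ := Metric.continuous_iff.1 hg z ε hε
    obtain ⟨n, hn⟩ := hpos δ hδ x
    obtain ⟨y, hy, hyx⟩ := ((frequently_ae_mem_iff.2 hn).and_eventually (hx n)).exists
    exact (hyx ▸ h y hy).le
  rw [integral_congr_ae hconst]
  simp

lemma ext_of_forall_isBddLipschitz {μ ν : Measure X} [IsProbabilityMeasure μ]
    [IsProbabilityMeasure ν] (h : ∀ f, IsBddLipschitz f → ∫ x, f x ∂μ = ∫ x, f x ∂ν) : μ = ν := by
  let μ' : ProbabilityMeasure X := ⟨μ, inferInstance⟩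
  let ν' : ProbabilityMeasure X := ⟨ν, inferInstance⟩
  have ht : Tendsto (fun _ : ℕ => μ') atTop (𝓝 ν') := by
    rw [tendsto_iff_forall_lipschitz_integral_tendsto]
    intro f hb hL
    have hb' : IsBddLipschitz f := by
      refine ⟨hL, ?_⟩
      rcases isEmpty_or_nonempty X with hX | ⟨⟨x₀⟩⟩
      · exact ⟨0, fun x => hX.elim x⟩
      obtain ⟨C, hC⟩ := hb
      refine ⟨C + |f x₀|, fun x => ?_⟩
      have h1 := hC x x₀
      rw [Real.dist_eq] at h1
      have h2 := abs_sub_abs_le_abs_sub (f x) (f x₀)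
      linarith
    change Tendsto (fun _ : ℕ => ∫ x, f x ∂μ) atTop (𝓝 (∫ x, f x ∂ν))
    rw [h f hb']
    exact tendsto_const_nhds
  have heq : μ' = ν' := tendsto_nhds_unique tendsto_const_nhds ht
  exact congrArg Subtype.val heq

variable {M} in
theorem EProperty.invariant_unique [SecondCountableTopology X] (hE : M.EProperty) {z : X}
    (hpos : ∀ δ : ℝ, 0 < δ → ∀ x, ∃ n : ℕ, M.Q (n + 1) x (ball z δ) ≠ 0)
    {μ ν : Measure X} [IsProbabilityMeasure μ] [IsProbabilityMeasure ν]
    (hμ : M.Invariant μ) (hν : M.Invariant ν) : μ = ν := by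
  have : Nonempty X := ⟨z⟩
  refine ext_of_forall_isBddLipschitz fun f hf => ?_
  obtain ⟨g, hg, ⟨C, hC⟩, hharm, hint⟩ := hE.exists_harmonic hf
  rw [← hint μ inferInstance hμ, ← hint ν inferInstance hν,
    M.integral_eq_of_harmonic hpos hg hC hharm hμ, M.integral_eq_of_harmonic hpos hg hC hharm hν]

end Uniqueness

section KrylovBogoliubov

variable {X : Type*} [MetricSpace X] [MeasurableSpace X] [BorelSpace X] (M : MarkovSemigroup X)

/-- The time average `Q^T(x, ·)` as a probability measure. -/
def QProb (T : ℝ) (x : X) : ProbabilityMeasure X := ⟨M.Q T x, inferInstance⟩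

variable {M} in
/-- Weak limits of time averages of a Feller semigroup are invariant. -/
lemma Feller.invariant_of_tendsto (hM : M.Feller) {x : X} {l : Filter ℝ} [l.NeBot]
    (hl : l ≤ atTop) {μ : ProbabilityMeasure X} (h : Tendsto (fun T => M.QProb T x) l (𝓝 μ)) :
    M.Invariant μ := by
  rw [ProbabilityMeasure.tendsto_iff_forall_integral_tendsto] at h
  intro t ht
  refine ext_of_forall_integral_eq_of_IsFiniteMeasure fun f => ?_
  have hfm := f.continuous.measurable
  have hC : ∀ x, |f x| ≤ ‖f‖ := f.norm_coe_le_norm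
  rw [M.integral_dual hfm hC]
  let g : BoundedContinuousFunction X ℝ := BoundedContinuousFunction.ofNormedAddCommGroup
    (M.act t f) (hM t ht f ⟨f.continuous, _, hC⟩) ‖f‖ (M.abs_act_le hC t)
  have h0 : Tendsto (fun T => 2 * ‖f‖ * t / T) l (𝓝 0) :=
    (tendsto_const_nhds.div_atTop tendsto_id).mono_left hl
  have h1 := (h g).sub (h f)
  have h2 : Tendsto (fun T => ∫ y, g y ∂(M.QProb T x : Measure X) -
      ∫ y, f y ∂(M.QProb T x : Measure X)) l (𝓝 0) := by
    refine squeeze_zero_norm' ?_ h0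
    filter_upwards [hl (eventually_gt_atTop 0)] with T hT
    exact M.abs_integral_act_QM_sub_le hfm hC ht hT _
  exact sub_eq_zero.1 (tendsto_nhds_unique h1 h2)

variable {M} in
lemma TightAt.exists_isCompact {x : X} (hx : M.TightAt x) :
    ∃ K : Set (ProbabilityMeasure X), IsCompact K ∧ ∀ᶠ T in atTop, M.QProb T x ∈ K := by
  refine ⟨_, isCompact_closure_of_isTightMeasureSet
    (S := (fun T => M.QProb T x) '' Ioi 0) ?_, ?_⟩
  · rw [isTightMeasureSet_iff_exists_isCompact_measure_compl_le]
    intro ε hε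
    obtain ⟨ε', hε', hle⟩ := ENNReal.lt_iff_exists_nnreal_btwn.1 hε
    obtain ⟨K, hK, h⟩ := hx ε' (by simpa using hε')
    refine ⟨K, hK, ?_⟩
    rintro _ ⟨_, ⟨T, hT, rfl⟩, rfl⟩
    change M.Q T x Kᶜ ≤ ε
    refine le_trans ?_ hle.le
    have h1 := h T hT
    have h2 := probReal_compl_eq_one_sub (μ := M.Q T x) hK.measurableSet
    rw [← ENNReal.ofReal_coe_nnreal, ← ofReal_measureReal]
    apply ENNReal.ofReal_le_ofReal
    rw [h2, Measure.real]
    linarith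
  · filter_upwards [eventually_gt_atTop 0] with T hT
    exact subset_closure ⟨T, hT, rfl⟩

variable {M} in
lemma Feller.exists_invariant_of_tightAt (hM : M.Feller) {x : X} (hx : M.TightAt x) :
    ∃ μ : Measure X, IsProbabilityMeasure μ ∧ M.Invariant μ := by
  obtain ⟨K, hK, hmem⟩ := hx.exists_isCompact
  obtain ⟨μ, -, hμ⟩ := hK.exists_mapClusterPt_of_frequently hmem.frequently
  obtain ⟨U, hU, h⟩ := mapClusterPt_iff_ultrafilter.1 hμ
  exact ⟨μ, inferInstance, hM.invariant_of_tendsto hU h⟩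

variable {M} in
lemma Feller.tendsto_QProb (hM : M.Feller) {μ : ProbabilityMeasure X}
    (hμ : ∀ ν : Measure X, IsProbabilityMeasure ν → M.Invariant ν → ν = μ) {x : X}
    (hx : M.TightAt x) : Tendsto (fun T => M.QProb T x) atTop (𝓝 μ) := by
  obtain ⟨K, hK, hmem⟩ := hx.exists_isCompact
  refine hK.tendsto_nhds_of_unique_mapClusterPt hmem fun ν _ hν => ?_
  obtain ⟨U, hU, h⟩ := mapClusterPt_iff_ultrafilter.1 hν
  exact Subtype.ext (hμ ν inferInstance (hM.invariant_of_tendsto hU h))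

variable {M} in
theorem Feller.QTendsto_of_tightAt [SecondCountableTopology X] (hM : M.Feller) {μ : Measure X}
    [IsProbabilityMeasure μ]
    (hμ : ∀ ν : Measure X, IsProbabilityMeasure ν → M.Invariant ν → ν = μ) {ν : Measure X}
    [IsProbabilityMeasure ν] (hν : ∀ x ∈ msupport ν, M.TightAt x) : M.QTendsto ν μ := by
  rintro f ⟨hf, C, hC⟩
  have hfm := hf.measurable
  let f' : BoundedContinuousFunction X ℝ :=
    BoundedContinuousFunction.ofNormedAddCommGroup f hf C hC
  have h : Tendsto (fun T => ∫ x, ∫ y, f y ∂(M.Q T x) ∂ν) atTop (𝓝 (∫ _, ∫ y, f y ∂μ ∂ν)) := by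
    refine tendsto_integral_filter_of_dominated_convergence (fun _ => C) ?_
      (Eventually.of_forall fun T => ae_of_all _ (M.abs_integral_Q_le hC T))
      (integrable_const _) ?_
    · filter_upwards [eventually_gt_atTop 0] with T hT
      exact (M.measurable_integral_Q hfm hC hT).aestronglyMeasurable
    · filter_upwards [ae_mem_msupport ν] with x hx
      exact ProbabilityMeasure.tendsto_iff_forall_integral_tendsto.1
        (hM.tendsto_QProb (μ := ⟨μ, inferInstance⟩) hμ (hν x hx)) f'
  simp only [integral_const, probReal_univ, one_smul] at h
  refine h.congr' ?_
  filter_upwards [eventually_gt_atTop 0] with T hT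
  exact (M.integral_QM_eq_integral_integral_Q hfm hC hT ν).symm

end KrylovBogoliubov

section Tightness

variable {X : Type*} [MetricSpace X] [MeasurableSpace X] [BorelSpace X] {M : MarkovSemigroup X}

/-- The e-property is uniform over all but finitely many members of a sequence of bumps with
disjoint supports. -/
lemma EProperty.exists_forall_bump (hE : M.EProperty) {E : ℕ → Set X} {ρ : ℝ} (hρ : 0 < ρ)
    (hdisj : Pairwise fun i j => Disjoint (thickening ρ (E i)) (thickening ρ (E j)))
    (z : X) {η : ℝ} (hη : 0 < η) :
    ∃ m : ℕ, ∃ δ : ℝ, 0 < δ ∧ ∀ i, m ≤ i → ∀ x, dist x z < δ → ∀ t, 0 ≤ t →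
      |M.act t (bump E hρ i) x - M.act t (bump E hρ i) z| ≤ η := by
  have hL : ∀ A, IsBddLipschitz (bumpUnion E hρ A) := fun A =>
    isBddLipschitz_thickenedIndicator hρ _
  have hm : ∀ A, Measurable (bumpUnion E hρ A) := fun A =>
    (hL A).1.choose_spec.continuous.measurable
  have hb : ∀ A x, |bumpUnion E hρ A x| ≤ 1 := fun A x => by
    rw [bumpUnion, NNReal.abs_eq]
    exact_mod_cast thickenedIndicator_le_one hρ _ x
  let F : ℕ → Set (ℕ → Bool) := fun N => {A | ∀ x, dist x z < 1 / (N + 1 : ℝ) → ∀ t, 0 ≤ t →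
    |M.act t (bumpUnion E hρ A) x - M.act t (bumpUnion E hρ A) z| ≤ η / 2}
  have hcont : ∀ t x, Continuous fun A => M.act t (bumpUnion E hρ A) x := fun t x =>
    continuous_of_dominated (fun A => (hm A).aestronglyMeasurable)
      (fun A => ae_of_all _ (hb A)) (integrable_const 1)
      (ae_of_all _ fun y => continuous_bumpUnion hρ hdisj y)
  have hclosed : ∀ N, IsClosed (F N) := by
    intro N
    simp only [F, ofPred_forall]
    refine isClosed_iInter fun x => isClosed_iInter fun _ => isClosed_iInter fun t =>
      isClosed_iInter fun _ => ?_
    exact isClosed_le ((hcont t x).sub (hcont t z)).abs continuous_const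
  have hunion : ⋃ N, F N = univ := by
    refine eq_univ_of_forall fun A => mem_iUnion.2 ?_
    obtain ⟨δ, hδ, h⟩ := hE _ (hL A) z (η / 2) (by positivity)
    obtain ⟨N, hN⟩ := exists_nat_one_div_lt hδ
    exact ⟨N, fun x hx t ht => (h x (hx.trans hN) t ht).le⟩
  obtain ⟨N, A, hA⟩ := nonempty_interior_of_iUnion_of_closed hclosed hunion
  have hupd : ∀ b, ∀ᶠ i in atTop, Function.update A i b ∈ F N := by
    intro b
    have ht : Tendsto (fun i => Function.update A i b) atTop (𝓝 A) := by
      rw [tendsto_pi_nhds]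
      intro j
      refine tendsto_const_nhds.congr' ?_
      filter_upwards [eventually_gt_atTop j] with i hi
      rw [Function.update_of_ne hi.ne]
    exact ht.eventually (mem_interior_iff_mem_nhds.1 hA)
  obtain ⟨m, hmN⟩ := eventually_atTop.1 ((hupd true).and (hupd false))
  refine ⟨m, 1 / (N + 1 : ℝ), by positivity, fun i hi x hx t ht => ?_⟩
  have hact : ∀ y, M.act t (bump E hρ i) y =
      M.act t (bumpUnion E hρ (Function.update A i true)) y -
        M.act t (bumpUnion E hρ (Function.update A i false)) y := by
    intro y
    simp only [act]
    rw [← integral_sub (integrable_of_abs_le (hm _) (hb _)) (integrable_of_abs_le (hm _) (hb _))]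
    simp_rw [← bump_eq_bumpUnion_sub hρ hdisj A i]
  have h1 := abs_le.1 ((hmN i hi).1 x hx t ht)
  have h2 := abs_le.1 ((hmN i hi).2 x hx t ht)
  rw [hact, hact, abs_le]
  constructor <;> linarith

/-- Time averages that, up to arbitrarily small mass, are supported on finitely many balls of
arbitrarily small radius form a tight family. -/
lemma tightAt_of_forall_finite_cover [CompleteSpace X] {x : X}
    (h : ∀ ε : NNReal, 0 < ε → ∀ r : ℝ, 0 < r → ∃ F : Set X, F.Finite ∧
      ∀ T, 0 < T → M.Q T x (⋃ y ∈ F, ball y r)ᶜ ≤ ε) : M.TightAt x := by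
  intro ε hε
  obtain ⟨ε', hε', hsum⟩ := ENNReal.exists_pos_sum_of_countable
    (ENNReal.ofReal_pos.2 hε).ne' ℕ
  choose F hF hFε using fun n : ℕ => h (ε' n) (hε' n) (1 / (n + 1 : ℝ)) (by positivity)
  set K : Set X := ⋂ n, ⋃ y ∈ F n, closedBall y (1 / (n + 1 : ℝ)) with hK
  have hKc : IsClosed K := isClosed_iInter fun n =>
    (hF n).isClosed_biUnion fun y _ => isClosed_closedBall
  have hKt : TotallyBounded K := by
    rw [Metric.totallyBounded_iff]
    intro r hr
    obtain ⟨n, hn⟩ := exists_nat_one_div_lt hr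
    exact ⟨F n, hF n, (iInter_subset _ n).trans
      (iUnion₂_mono fun y _ => closedBall_subset_ball hn)⟩
  refine ⟨K, hKt.isCompact_of_isClosed hKc, fun T hT => ?_⟩
  have hle : M.Q T x Kᶜ ≤ ENNReal.ofReal ε := by
    rw [hK, compl_iInter]
    refine (measure_iUnion_le _).trans ((ENNReal.tsum_le_tsum fun n => ?_).trans hsum.le)
    refine (measure_mono (compl_subset_compl.2 ?_)).trans (hFε n T hT)
    exact iUnion₂_mono fun y _ => ball_subset_closedBall
  have h1 := probReal_compl_eq_one_sub (μ := M.Q T x) hKc.measurableSet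
  have h2 := ENNReal.toReal_le_of_le_ofReal hε.le hle
  rw [Measure.real, Measure.real] at h1
  linarith

/-- Under the e-property, the time averages from a point `z` that charge every ball around `z`
form a tight family. -/
theorem EProperty.tightAt [CompleteSpace X] [SecondCountableTopology X] (hE : M.EProperty) {z : X}
    (hz : ∀ δ : ℝ, 0 < δ → ∃ α : ℝ, 0 < α ∧ ∀ᶠ T in atTop, α ≤ (M.Q T z).real (ball z δ)) :
    M.TightAt z := by
  by_contra hnot
  obtain ⟨ε, hε, r, hr, hfail⟩ : ∃ ε : NNReal, 0 < ε ∧ ∃ r : ℝ, 0 < r ∧ ∀ F : Set X, F.Finite →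
      ∃ T, 0 < T ∧ ε < M.Q T z (⋃ y ∈ F, ball y r)ᶜ := by
    by_contra! h
    exact hnot (tightAt_of_forall_finite_cover h)
  obtain ⟨G, hG, hsep⟩ := exists_seq_of_forall_finset_exists
    (fun G : Set X => G.Finite ∧ ∃ S, 0 < S ∧ ε < M.Q S z (⋃ y ∈ G, ball y (r / 8)))
    (fun G H => ∀ w ∈ G, ∀ y ∈ H, r ≤ dist y w) (by
      intro s hs
      obtain ⟨S, hS, hlt⟩ := hfail (⋃ G ∈ s, G) (s.finite_toSet.biUnion fun G hG => (hs G hG).1)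
      obtain ⟨H, hHsub, hH, hlt'⟩ := exists_finite_cover_of_lt_measure _ hlt
        (by positivity : 0 < r / 8)
      refine ⟨H, ⟨hH, S, hS, hlt'⟩, fun G hG w hw y hy => ?_⟩
      by_contra! hlt
      exact hHsub hy (mem_iUnion₂.2 ⟨w, mem_iUnion₂.2 ⟨G, hG, hw⟩, hlt⟩))
  choose hGfin S hS hlt using hG
  set E : ℕ → Set X := fun i => ⋃ y ∈ G i, ball y (r / 8) with hEdef
  have hρ : 0 < r / 8 := by positivity
  have hclose : ∀ i x, x ∈ thickening (r / 8) (E i) → ∃ y ∈ G i, dist x y < r / 4 := by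
    intro i x hx
    obtain ⟨e, he, hxe⟩ := mem_thickening_iff.1 hx
    obtain ⟨y, hy, hey⟩ := mem_iUnion₂.1 he
    have := dist_triangle x e y
    rw [mem_ball] at hey
    exact ⟨y, hy, by linarith⟩
  have hlt_disj : ∀ i j, i < j →
      Disjoint (thickening (r / 8) (E i)) (thickening (r / 8) (E j)) := by
    intro i j hij
    refine disjoint_left.2 fun x hxi hxj => ?_
    obtain ⟨w, hw, hxw⟩ := hclose i x hxi
    obtain ⟨y, hy, hxy⟩ := hclose j x hxj
    have h1 := hsep i j hij w hw y hy
    have h2 := dist_triangle_left y w x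
    linarith
  have hdisj : Pairwise fun i j =>
      Disjoint (thickening (r / 8) (E i)) (thickening (r / 8) (E j)) := fun i j hij =>
    hij.lt_or_gt.elim (hlt_disj i j) fun h => (hlt_disj j i h).symm
  have hε' : (0 : ℝ) < ε := hε
  obtain ⟨m, δ, hδ, hosc⟩ := hE.exists_forall_bump hρ hdisj z (half_pos hε')
  obtain ⟨α, hα, hball⟩ := hz δ hδ
  have hbm : ∀ i, Measurable (bump E hρ i) := fun i =>
    (isBddLipschitz_thickenedIndicator hρ _).1.choose_spec.continuous.measurable
  have hb : ∀ i x, |bump E hρ i x| ≤ 1 := fun i x => by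
    rw [abs_of_nonneg (bump_nonneg hρ i x)]
    exact bump_le_one hρ i x
  have hEm : ∀ i, MeasurableSet (E i) := fun i =>
    (isOpen_biUnion fun y _ => isOpen_ball).measurableSet
  have hmass : ∀ i, (ε : ℝ) ≤ ∫ y, bump E hρ i y ∂(M.Q (S i) z) := by
    intro i
    have h1 : (ε : ℝ) ≤ (M.Q (S i) z).real (E i) := by
      rw [← ENNReal.coe_toReal ε]
      exact ENNReal.toReal_mono (measure_ne_top _ _) (hlt i).le
    refine h1.trans ?_
    rw [← integral_indicator_one (hEm i)]
    refine integral_mono ((integrable_const 1).indicator (hEm i))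
      (integrable_of_abs_le (hbm i) (hb i)) fun y => indicator_le' (fun y hy => ?_)
        (fun y _ => bump_nonneg hρ i y) y
    rw [bump_eq_one hρ hy, Pi.one_apply]
  have hlow : ∀ i, m ≤ i → ∀ x ∈ ball z δ, (ε : ℝ) / 2 ≤ ∫ y, bump E hρ i y ∂(M.Q (S i) x) := by
    intro i hi x hx
    have h1 := abs_le.1 (M.abs_integral_Q_sub_integral_Q_le (hbm i) (hb i) (hosc i hi x hx) (hS i))
    have h2 := hmass i
    linarith
  have hev : ∀ i, m ≤ i → ∀ᶠ T in atTop, α * ε / 4 ≤ ∫ y, bump E hρ i y ∂(M.Q T z) := by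
    intro i hi
    have h0 : Tendsto (fun T => 2 * 1 * S i / T) atTop (𝓝 0) :=
      tendsto_const_nhds.div_atTop tendsto_id
    filter_upwards [hball, eventually_gt_atTop 0,
      h0.eventually_lt_const (by positivity : 0 < α * ε / 4)] with T hT hT0 hTS
    have h1 := abs_le.1 (M.abs_integral_integral_Q_sub_le (hbm i) (hb i) (hS i) hT0
      (Measure.dirac z) zero_le_one)
    have h2 : (M.Q T z).real (ball z δ) * (ε / 2) ≤
        ∫ x, ∫ y, bump E hρ i y ∂(M.Q (S i) x) ∂(M.Q T z) := by
      rw [← smul_eq_mul, ← integral_indicator_const _ measurableSet_ball]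
      refine integral_mono ((integrable_const _).indicator measurableSet_ball)
        (integrable_of_abs_le (M.measurable_integral_Q (hbm i) (hb i) (hS i))
          (M.abs_integral_Q_le (hb i) _)) fun x => indicator_le' (hlow i hi)
            (fun x _ => integral_nonneg (bump_nonneg hρ i)) x
    have h3 : α * (ε / 2) ≤ (M.Q T z).real (ball z δ) * (ε / 2) := by gcongr
    rw [Q] at h2 h3 ⊢
    linarith
  obtain ⟨N, hN⟩ := exists_nat_gt (1 / (α * ε / 4))
  rw [div_lt_iff₀ (by positivity)] at hN
  obtain ⟨T, hT⟩ := ((Finset.eventually_all (Finset.Ico m (m + N))).2 fun i hi =>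
    hev i (Finset.mem_Ico.1 hi).1).exists
  have h1 := Finset.sum_le_sum hT
  rw [← integral_finsetSum _ fun i _ => integrable_of_abs_le (hbm i) (hb i)] at h1
  have h2 : ∫ x, ∑ i ∈ Finset.Ico m (m + N), bump E hρ i x ∂(M.Q T z) ≤ 1 := by
    refine (integral_mono (integrable_finsetSum _ fun i _ => integrable_of_abs_le (hbm i) (hb i))
      (integrable_const 1) (sum_bump_le_one hρ hdisj _)).trans ?_
    simp
  simp only [Finset.sum_const, Nat.card_Ico, add_tsub_cancel_left, nsmul_eq_mul] at h1
  linarith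

end Tightness

end MarkovSemigroup

/-- Theorem 1 of the paper. A Feller, stochastically continuous
Markov semigroup with the e-property and a point `z` whose every ball has positive
lower-bounded ergodic averages from every starting point admits a unique invariant
probability measure `μ*`, and `Q^T ν → μ*` weakly for every probability measure `ν`
supported in the set `𝒯` of points with tight ergodic averages. -/
theorem exists_unique_invariant_of_eProperty_and_lower_bound
    {X : Type*} [MetricSpace X] [CompleteSpace X] [SecondCountableTopology X]
    [MeasurableSpace X] [BorelSpace X]
    (M : MarkovSemigroup X)
    (hFeller : M.Feller) (hSC : M.StochasticallyContinuous) (hE : M.EProperty)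
    (z : X)
    (hlow : ∀ δ : ℝ, 0 < δ → ∀ x : X,
      0 < Filter.liminf (fun T : ℝ => ((M.Q T x) (Metric.ball z δ)).toReal)
        Filter.atTop) :
    ∃ μstar : MeasureTheory.Measure X,
      MeasureTheory.IsProbabilityMeasure μstar ∧ M.Invariant μstar ∧
      (∀ μ : MeasureTheory.Measure X, MeasureTheory.IsProbabilityMeasure μ →
        M.Invariant μ → μ = μstar) ∧
      (∀ ν : MeasureTheory.Measure X, MeasureTheory.IsProbabilityMeasure ν →
        (∀ x ∈ msupport ν, M.TightAt x) → M.QTendsto ν μstar) := by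
  have hev : ∀ δ : ℝ, 0 < δ → ∀ x, ∃ α : ℝ, 0 < α ∧
      ∀ᶠ T in atTop, α < (M.Q T x).real (ball z δ) := by
    intro δ hδ x
    obtain ⟨α, hα, hlt⟩ := exists_between (hlow δ hδ x)
    exact ⟨α, hα, eventually_lt_of_lt_liminf hlt
      (isBoundedUnder_of ⟨0, fun T => ENNReal.toReal_nonneg⟩)⟩
  have hpos : ∀ δ : ℝ, 0 < δ → ∀ x, ∃ n : ℕ, M.Q (n + 1) x (ball z δ) ≠ 0 := by
    intro δ hδ x
    obtain ⟨α, hα, h⟩ := hev δ hδ x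
    obtain ⟨n, hn⟩ := ((tendsto_atTop_add_const_right _ (1 : ℝ)
      tendsto_natCast_atTop_atTop).eventually h).exists
    refine ⟨n, fun h0 => ?_⟩
    rw [Measure.real, h0, ENNReal.toReal_zero] at hn
    exact hα.not_gt hn
  have htight : M.TightAt z := hE.tightAt fun δ hδ => by
    obtain ⟨α, hα, h⟩ := hev δ hδ z
    exact ⟨α, hα, h.mono fun T hT => hT.le⟩
  obtain ⟨μ, hμ, hinv⟩ := hFeller.exists_invariant_of_tightAt htight
  have huniq : ∀ ν : Measure X, IsProbabilityMeasure ν → M.Invariant ν → ν = μ :=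
    fun ν _ hν => hE.invariant_unique hpos hν hinv
  exact ⟨μ, hμ, hinv, huniq, fun ν _ hν => hFeller.QTendsto_of_tightAt huniq hν⟩
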